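/- Let T be an n-node ordered tree rooted at a leaf, let Γ0 be an order-preserving straight-line planar grid drawing of T, and let D0 = max{w(Γ0),h(Γ0)}. Then there is an integer B0 ∈ O(D0³·n) (in particular B0 = 800·D0³·n suffices) such that the drawing Δ0 obtained by scaling Γ0 up by the factor B0 is a partially-canonical drawing of T[0], where T[0] is T with all leaves labeled visited and all internal nodes labeled unvisited. -/

import Mathlib

open Real Set

/-- A finite rooted ordered tree: a root, a parent function (fixing the root),
well-foundedness (every node reaches the root by iterating `parent`), and a
rank function giving the left-to-right order among siblings. -/
structure OTree (V : Type) [Fintype V] [DecidableEq V] where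
  root : V
  parent : V → V
  parent_root : parent root = root
  reach : ∀ v : V, ∃ n : ℕ, parent^[n] v = root
  rank : V → ℕ
  rank_inj : ∀ u v : V, u ≠ root → v ≠ root →
    parent u = parent v → rank u = rank v → u = v

variable {V : Type} [Fintype V] [DecidableEq V]

/-- `c` is a child of `v`. -/
def OTree.IsChild (T : OTree V) (c v : V) : Prop := c ≠ T.root ∧ T.parent c = v

/-- A leaf is a node with no children. -/
def OTree.IsLeaf (T : OTree V) (v : V) : Prop := ∀ c, ¬ T.IsChild c v

/-- `a` is an ancestor of `w`, or `a = w`. -/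
def OTree.AncEq (T : OTree V) (a w : V) : Prop := ∃ n : ℕ, T.parent^[n] w = a

/-- A drawing is strictly upward if every non-root node lies strictly below its parent. -/
def IsUpwardD (T : OTree V) (Γ : V → ℝ × ℝ) : Prop :=
  ∀ v, v ≠ T.root → (Γ v).2 < (Γ (T.parent v)).2

/-- A straight-line drawing is planar if it is injective on nodes and any two distinct
edge segments meet only in (images of) shared endpoints. -/
def IsPlanarD (T : OTree V) (Γ : V → ℝ × ℝ) : Prop :=
  Function.Injective Γ ∧
  ∀ u v : V, u ≠ T.root → v ≠ T.root → u ≠ v →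
    segment ℝ (Γ u) (Γ (T.parent u)) ∩ segment ℝ (Γ v) (Γ (T.parent v)) ⊆
      Γ '' (({u, T.parent u} : Set V) ∩ {v, T.parent v})

/-- The angle of the direction from `p` to `q`. -/
noncomputable def dirAngle (p q : ℝ × ℝ) : ℝ :=
  Complex.arg (Complex.ofReal (q.1 - p.1) + Complex.ofReal (q.2 - p.2) * Complex.I)

/-- Normalization of an angle into the window `[a, a + 2π)`. -/
noncomputable def normAngle (a θ : ℝ) : ℝ := θ - 2 * π * (⌊(θ - a) / (2 * π)⌋ : ℤ)

/-- The angle of the direction from `Γ v` to `Γ w`, normalized into `[a, a + 2π)`. -/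
noncomputable def angFrom (Γ : V → ℝ × ℝ) (a : ℝ) (v w : V) : ℝ :=
  normAngle a (dirAngle (Γ v) (Γ w))

/-- A drawing is order-preserving if around every node the counterclockwise cyclic
order of the incident edges is: edge to the parent, then edges to the children in
left-to-right order. -/
def IsOrderPreservingD (T : OTree V) (Γ : V → ℝ × ℝ) : Prop :=
  ∀ v : V, ∃ a : ℝ,
    (∀ c₁ c₂ : V, T.IsChild c₁ v → T.IsChild c₂ v → T.rank c₁ < T.rank c₂ →
      angFrom Γ a v c₁ < angFrom Γ a v c₂) ∧
    (v ≠ T.root → ∀ c : V, T.IsChild c v →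
      angFrom Γ a v (T.parent v) < angFrom Γ a v c)

/-- A grid drawing places every node at integer coordinates. -/
def IsGridD (Γ : V → ℝ × ℝ) : Prop :=
  ∀ v, (∃ a : ℤ, (Γ v).1 = a) ∧ (∃ b : ℤ, (Γ v).2 = b)

/-- The width of a (grid) drawing: number of grid columns met by its bounding box. -/
noncomputable def gW (Γ : V → ℝ × ℝ) : ℝ :=
  sSup (Set.range fun v => (Γ v).1) - sInf (Set.range fun v => (Γ v).1) + 1

/-- The height of a (grid) drawing: number of grid rows met by its bounding box. -/
noncomputable def gH (Γ : V → ℝ × ℝ) : ℝ :=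
  sSup (Set.range fun v => (Γ v).2) - sInf (Set.range fun v => (Γ v).2) + 1

/-- The drawing at time `t` of the linear morph from `Γ₀` to `Γ₁`. -/
def lerpD (t : ℝ) (Γ₀ Γ₁ : V → ℝ × ℝ) : V → ℝ × ℝ :=
  fun v => (1 - t) • Γ₀ v + t • Γ₁ v

/-- The linear morph from `Γ₀` to `Γ₁` is planar. -/
def PlanarStep (T : OTree V) (Γ₀ Γ₁ : V → ℝ × ℝ) : Prop :=
  ∀ t ∈ Set.Icc (0:ℝ) 1, IsPlanarD T (lerpD t Γ₀ Γ₁)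

/-- The linear morph from `Γ₀` to `Γ₁` is upward. -/
def UpwardStep (T : OTree V) (Γ₀ Γ₁ : V → ℝ × ℝ) : Prop :=
  ∀ t ∈ Set.Icc (0:ℝ) 1, IsUpwardD T (lerpD t Γ₀ Γ₁)

/-- `w` strictly precedes `v` in the pre-order traversal of `T`: either `w` is a proper
ancestor of `v`, or there are siblings `a, b` with `rank a < rank b` such that `a` is an
ancestor (or equal) of `w` and `b` is an ancestor (or equal) of `v`. -/
def preLT (T : OTree V) (w v : V) : Prop :=
  (w ≠ v ∧ T.AncEq w v) ∨
  ∃ a b : V, a ≠ T.root ∧ b ≠ T.root ∧ T.parent a = T.parent b ∧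
    T.rank a < T.rank b ∧ T.AncEq a w ∧ T.AncEq b v

/-- The depth of a node: the least number of `parent` steps reaching the root. -/
noncomputable def depthT (T : OTree V) (v : V) : ℕ := Nat.find (T.reach v)

/-- The pre-order index of `w` within the subtree rooted at `u`. -/
noncomputable def relIdx (T : OTree V) (u w : V) : ℕ :=
  Nat.card {w' : V // T.AncEq u w' ∧ preLT T w' w}

/-- The drawing of the subtree rooted at `u` is an upward canonical drawing: for some
grid point `(x₀, y₀)` (the position of `u`), every node `w` of the subtree is placed
at `x₀ +` (pre-order index of `w` in the subtree) and `y₀ -` (depth of `w` below `u`). -/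
def UpCanonicalOn (T : OTree V) (u : V) (Γ : V → ℝ × ℝ) : Prop :=
  ∃ x₀ y₀ : ℤ, ∀ w, T.AncEq u w →
    Γ w = (((x₀ + (relIdx T u w : ℤ) : ℤ) : ℝ),
           ((y₀ - ((depthT T w : ℤ) - (depthT T u : ℤ)) : ℤ) : ℝ))

/-- Counterclockwise rotation of the plane by `π/2` about the origin. -/
def rotCCW (p : ℝ × ℝ) : ℝ × ℝ := (-p.2, p.1)

/-- The drawing of the subtree rooted at `u` is a downward canonical drawing:
an upward canonical drawing rotated by `π` (i.e. by `π/2` twice). -/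
def DownCanonicalOn (T : OTree V) (u : V) (Γ : V → ℝ × ℝ) : Prop :=
  ∃ Γ' : V → ℝ × ℝ, UpCanonicalOn T u Γ' ∧
    ∀ w, T.AncEq u w → Γ w = rotCCW (rotCCW (Γ' w))

/-- An upward canonical drawing of the whole tree. -/
def IsUpCanonical (T : OTree V) (Γ : V → ℝ × ℝ) : Prop := UpCanonicalOn T T.root Γ

/-- A leftward canonical drawing: an upward canonical drawing rotated
counterclockwise by `π/2`. -/
def IsLeftCanonical (T : OTree V) (Γ : V → ℝ × ℝ) : Prop :=
  ∃ Γ', IsUpCanonical T Γ' ∧ ∀ v, Γ v = rotCCW (Γ' v)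

/-- A downward canonical drawing: an upward canonical drawing rotated by `π`. -/
def IsDownCanonical (T : OTree V) (Γ : V → ℝ × ℝ) : Prop :=
  ∃ Γ', IsUpCanonical T Γ' ∧ ∀ v, Γ v = rotCCW (rotCCW (Γ' v))

/-- A rightward canonical drawing: an upward canonical drawing rotated
counterclockwise by `3π/2`. -/
def IsRightCanonical (T : OTree V) (Γ : V → ℝ × ℝ) : Prop :=
  ∃ Γ', IsUpCanonical T Γ' ∧ ∀ v, Γ v = rotCCW (rotCCW (rotCCW (Γ' v)))

/-- A canonical drawing: upward, leftward, downward or rightward canonical. -/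
def IsCanonical (T : OTree V) (Γ : V → ℝ × ℝ) : Prop :=
  IsUpCanonical T Γ ∨ IsLeftCanonical T Γ ∨ IsDownCanonical T Γ ∨ IsRightCanonical T Γ

/-- The `ℓ`-box centered at the point `c`: the axis-parallel square of side `ℓ`
with corners `c ± (ℓ/2, ℓ/2)`. -/
def boxAt (ℓ : ℝ) (c : ℝ × ℝ) : Set (ℝ × ℝ) :=
  {p | |p.1 - c.1| ≤ ℓ / 2 ∧ |p.2 - c.2| ≤ ℓ / 2}

/-- `S` is a (filled) sector of a circumference centered at `c`: for some radius
`ρ > 0` and angles `θ₁ ≤ θ₂ ≤ θ₁ + 2π`, `S` is the set of points `c + r·(cos θ, sin θ)`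
with `0 ≤ r ≤ ρ` and `θ₁ ≤ θ ≤ θ₂`. -/
def IsSector (c : ℝ × ℝ) (S : Set (ℝ × ℝ)) : Prop :=
  ∃ ρ θ₁ θ₂ : ℝ, 0 < ρ ∧ θ₁ ≤ θ₂ ∧ θ₂ ≤ θ₁ + 2 * π ∧
    S = {p | ∃ r θ : ℝ, 0 ≤ r ∧ r ≤ ρ ∧ θ₁ ≤ θ ∧ θ ≤ θ₂ ∧
      p = (c.1 + r * Real.cos θ, c.2 + r * Real.sin θ)}

/-- `Γ` is a partially-canonical drawing of `T` with respect to the labeling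
`visited` (Definition 2 of the paper, with `n` the number of nodes and `ℓ₀` the
parameter `150·D₀²·n`): an order-preserving straight-line planar grid drawing such
that
(a) the subtree of each visited node is drawn upward or downward canonically
    (upward when the node does not lie above its parent, downward otherwise);
(b) each edge `e = (v, u)` from an unvisited node `v` to a child `u` has a sector
    `S u` of a circumference centered at `v` such that (b.i) `S u` encloses the
    `2n`-box of `u`; (b.ii) `S u` contains no node except `v` and nodes of `T_u` and
    meets no edge except `e` and edges of `T_u` (other edges may touch `S u` only at
    `v`); (b.iii) `S u ∩ B_{ℓ₀}(v)` contains a `2n`-box with integer corner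
    coordinates whose center is weakly below `v` iff `u` is; (b.iv) the sectors of
    distinct edges out of `v` have disjoint interiors;
(c) the `(ℓ₀+4n)`-boxes of distinct unvisited nodes are disjoint;
(d) the `(ℓ₀+4n)`-box of an unvisited node `v` contains no node other than `v`, and
    every edge or sector meeting it belongs to an edge incident to `v`. -/
def PartiallyCanonical (T : OTree V) (visited : V → Prop) (ℓ₀ : ℝ)
    (Γ : V → ℝ × ℝ) : Prop :=
  IsOrderPreservingD T Γ ∧ IsPlanarD T Γ ∧ IsGridD Γ ∧
  -- (a)
  (∀ u, visited u →
    (UpCanonicalOn T u Γ ∨ DownCanonicalOn T u Γ) ∧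
    (u ≠ T.root →
      ((Γ u).2 ≤ (Γ (T.parent u)).2 → UpCanonicalOn T u Γ) ∧
      ((Γ (T.parent u)).2 < (Γ u).2 → DownCanonicalOn T u Γ))) ∧
  -- (b)
  (∃ S : V → Set (ℝ × ℝ),
    (∀ u, u ≠ T.root → ¬ visited (T.parent u) →
      IsSector (Γ (T.parent u)) (S u) ∧
      boxAt (2 * (Fintype.card V : ℝ)) (Γ u) ⊆ S u ∧
      (∀ w, Γ w ∈ S u → w = T.parent u ∨ T.AncEq u w) ∧
      (∀ w, w ≠ T.root → ¬ T.AncEq u w →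
        segment ℝ (Γ w) (Γ (T.parent w)) ∩ S u ⊆ {Γ (T.parent u)}) ∧
      (∃ cu : ℤ × ℤ,
        boxAt (2 * (Fintype.card V : ℝ)) ((cu.1 : ℝ), (cu.2 : ℝ)) ⊆
          S u ∩ boxAt ℓ₀ (Γ (T.parent u)) ∧
        ((cu.2 : ℝ) ≤ (Γ (T.parent u)).2 ↔ (Γ u).2 ≤ (Γ (T.parent u)).2))) ∧
    (∀ u u', u ≠ T.root → u' ≠ T.root → ¬ visited (T.parent u) →
      T.parent u = T.parent u' → u ≠ u' →
      interior (S u) ∩ interior (S u') = ∅) ∧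
    (∀ v, ¬ visited v → ∀ u, u ≠ T.root → ¬ visited (T.parent u) →
      (S u ∩ boxAt (ℓ₀ + 4 * (Fintype.card V : ℝ)) (Γ v)).Nonempty →
      T.parent u = v ∨ u = v)) ∧
  -- (c)
  (∀ v w, ¬ visited v → ¬ visited w → v ≠ w →
    boxAt (ℓ₀ + 4 * (Fintype.card V : ℝ)) (Γ v) ∩
      boxAt (ℓ₀ + 4 * (Fintype.card V : ℝ)) (Γ w) = ∅) ∧
  -- (d)
  (∀ v, ¬ visited v →
    (∀ w, w ≠ v → Γ w ∉ boxAt (ℓ₀ + 4 * (Fintype.card V : ℝ)) (Γ v)) ∧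
    (∀ w, w ≠ T.root →
      (segment ℝ (Γ w) (Γ (T.parent w)) ∩
        boxAt (ℓ₀ + 4 * (Fintype.card V : ℝ)) (Γ v)).Nonempty →
      T.parent w = v ∨ w = v))

/-- The subring of real numbers that are integers. -/
abbrev intReals : Subring ℝ := (Int.castRingHom ℝ).range

theorem mem_intReals_iff {x : ℝ} : x ∈ intReals ↔ ∃ a : ℤ, x = a := by
  simp [intReals, RingHom.mem_range, eq_comm]

theorem eq_zero_of_mem_intReals {x : ℝ} (hx : x ∈ intReals) (h : |x| < 1) : x = 0 := by
  obtain ⟨a, rfl⟩ := mem_intReals_iff.1 hx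
  have : |a| < 1 := by exact_mod_cast h
  simp [Int.abs_lt_one_iff.1 this]

theorem le_of_mem_intReals_of_lt {x y : ℝ} (hx : x ∈ intReals) (hy : y ∈ intReals)
    (h : x < y + 1) : x ≤ y := by
  obtain ⟨a, rfl⟩ := mem_intReals_iff.1 hx
  obtain ⟨b, rfl⟩ := mem_intReals_iff.1 hy
  have : a < b + 1 := by exact_mod_cast h
  exact_mod_cast Int.lt_add_one_iff.1 this

theorem mul_nonpos_of_abs_convex_comb_lt_one {A B r : ℝ} (hA : A ∈ intReals)
    (hB : B ∈ intReals) (h0 : 0 ≤ r) (h1 : r ≤ 1) (h : |(1 - r) * A + r * B| < 1) :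
    A * B ≤ 0 := by
  by_contra! hc
  obtain ⟨h2, h3⟩ := abs_lt.1 h
  rcases pos_and_pos_or_neg_and_neg_of_mul_pos hc with ⟨a, b⟩ | ⟨a, b⟩
  · have a' : 1 ≤ A := le_of_mem_intReals_of_lt (one_mem _) hA (by linarith)
    have b' : 1 ≤ B := le_of_mem_intReals_of_lt (one_mem _) hB (by linarith)
    nlinarith
  · have a' : A ≤ -1 := le_of_mem_intReals_of_lt hA (neg_mem (one_mem _)) (by linarith)
    have b' : B ≤ -1 := le_of_mem_intReals_of_lt hB (neg_mem (one_mem _)) (by linarith)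
    nlinarith

theorem neg_div_sub_mem_Icc {A B : ℝ} (h : A * B ≤ 0) (hN : B - A ≠ 0) :
    -A / (B - A) ∈ Icc (0 : ℝ) 1 := by
  have e : -A / (B - A) = (A ^ 2 - A * B) / (B - A) ^ 2 := by
    field_simp
    ring
  have hp : 0 < (B - A) ^ 2 := by positivity
  rw [e]
  constructor
  · apply div_nonneg _ hp.le
    nlinarith [sq_nonneg A]
  · rw [div_le_one hp]
    nlinarith [sq_nonneg B]

/-- Intervals with integer endpoints that come closer than `1` to each other intersect. -/
theorem exists_mem_uIcc_inter {V U A B x y : ℝ} (hV : V ∈ intReals) (hU : U ∈ intReals)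
    (hA : A ∈ intReals) (hB : B ∈ intReals) (hx : x ∈ uIcc V U) (hy : y ∈ uIcc A B)
    (h : |x - y| < 1) : ∃ z, z ∈ uIcc V U ∧ z ∈ uIcc A B := by
  have hmin : ∀ {a b : ℝ}, a ∈ intReals → b ∈ intReals → min a b ∈ intReals := by
    intro a b ha hb
    rcases min_choice a b with h | h <;> rwa [h]
  have hmax : ∀ {a b : ℝ}, a ∈ intReals → b ∈ intReals → max a b ∈ intReals := by
    intro a b ha hb
    rcases max_choice a b with h | h <;> rwa [h]
  obtain ⟨h2, h3⟩ := abs_lt.1 h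
  obtain ⟨x1, x2⟩ := hx
  obtain ⟨y1, y2⟩ := hy
  have k1 : min V U ≤ max A B :=
    le_of_mem_intReals_of_lt (hmin hV hU) (hmax hA hB) (by linarith)
  have k2 : min A B ≤ max V U :=
    le_of_mem_intReals_of_lt (hmin hA hB) (hmax hV hU) (by linarith)
  exact ⟨max (min V U) (min A B), ⟨le_max_left _ _, max_le min_le_max k2⟩,
    ⟨le_max_right _ _, max_le k1 min_le_max⟩⟩

theorem mem_uIcc_iff_exists {a b z : ℝ} :
    z ∈ uIcc a b ↔ ∃ s ∈ Icc (0 : ℝ) 1, a + s * (b - a) = z := by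
  rw [← segment_eq_uIcc, segment_eq_image']
  simp

theorem exists_common_point_of_collinear {v₁ v₂ u₁ u₂ a₁ a₂ b₁ b₂ s r : ℝ}
    (hv : v₁ ∈ intReals) (hu : u₁ ∈ intReals) (ha : a₁ ∈ intReals) (hb : b₁ ∈ intReals)
    (hne : u₁ - v₁ ≠ 0)
    (hfa : (u₁ - v₁) * (a₂ - v₂) - (u₂ - v₂) * (a₁ - v₁) = 0)
    (hfb : (u₁ - v₁) * (b₂ - v₂) - (u₂ - v₂) * (b₁ - v₁) = 0)
    (hs : s ∈ Icc (0 : ℝ) 1) (hr : r ∈ Icc (0 : ℝ) 1)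
    (h : |(v₁ + s * (u₁ - v₁)) - (a₁ + r * (b₁ - a₁))| < 1) :
    ∃ s' ∈ Icc (0 : ℝ) 1, ∃ r' ∈ Icc (0 : ℝ) 1,
      v₁ + s' * (u₁ - v₁) = a₁ + r' * (b₁ - a₁) ∧
      v₂ + s' * (u₂ - v₂) = a₂ + r' * (b₂ - a₂) := by
  obtain ⟨z, hz1, hz2⟩ := exists_mem_uIcc_inter hv hu ha hb
    (mem_uIcc_iff_exists.2 ⟨s, hs, rfl⟩) (mem_uIcc_iff_exists.2 ⟨r, hr, rfl⟩) h
  obtain ⟨s', hs', e1⟩ := mem_uIcc_iff_exists.1 hz1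
  obtain ⟨r', hr', e2⟩ := mem_uIcc_iff_exists.1 hz2
  refine ⟨s', hs', r', hr', by rw [e1, e2], ?_⟩
  apply mul_left_cancel₀ hne
  linear_combination (u₂ - v₂) * (e1 - e2) - (1 - r') * hfa - r' * hfb

/-- Two segments with integer endpoints, one of them non-degenerate, whose extents are at most
`D` and that come closer than `1 / (2 D)` to each other in the sup norm intersect. -/
theorem exists_common_point_of_close {D v₁ v₂ u₁ u₂ a₁ a₂ b₁ b₂ s r : ℝ} (hD : 1 ≤ D)
    (hv1 : v₁ ∈ intReals) (hv2 : v₂ ∈ intReals) (hu1 : u₁ ∈ intReals) (hu2 : u₂ ∈ intReals)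
    (ha1 : a₁ ∈ intReals) (ha2 : a₂ ∈ intReals) (hb1 : b₁ ∈ intReals) (hb2 : b₂ ∈ intReals)
    (hne : u₁ - v₁ ≠ 0 ∨ u₂ - v₂ ≠ 0)
    (hd1 : |u₁ - v₁| ≤ D) (hd2 : |u₂ - v₂| ≤ D) (he1 : |b₁ - a₁| ≤ D) (he2 : |b₂ - a₂| ≤ D)
    (hs : s ∈ Icc (0 : ℝ) 1) (hr : r ∈ Icc (0 : ℝ) 1)
    (h1 : 2 * D * |(v₁ + s * (u₁ - v₁)) - (a₁ + r * (b₁ - a₁))| < 1)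
    (h2 : 2 * D * |(v₂ + s * (u₂ - v₂)) - (a₂ + r * (b₂ - a₂))| < 1) :
    ∃ s' ∈ Icc (0 : ℝ) 1, ∃ r' ∈ Icc (0 : ℝ) 1,
      v₁ + s' * (u₁ - v₁) = a₁ + r' * (b₁ - a₁) ∧
      v₂ + s' * (u₂ - v₂) = a₂ + r' * (b₂ - a₂) := by
  set δ₁ := (v₁ + s * (u₁ - v₁)) - (a₁ + r * (b₁ - a₁)) with hδ1
  set δ₂ := (v₂ + s * (u₂ - v₂)) - (a₂ + r * (b₂ - a₂)) with hδ2
  have hcr : ∀ x y : ℝ, |x| ≤ D → |y| ≤ D → |x * δ₂ - y * δ₁| < 1 := by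
    intro x y hx hy
    have := abs_sub (x * δ₂) (y * δ₁)
    rw [abs_mul, abs_mul] at this
    nlinarith [mul_le_mul_of_nonneg_right hx (abs_nonneg δ₂),
      mul_le_mul_of_nonneg_right hy (abs_nonneg δ₁)]
  set A := (u₁ - v₁) * (a₂ - v₂) - (u₂ - v₂) * (a₁ - v₁) with hA
  set B := (u₁ - v₁) * (b₂ - v₂) - (u₂ - v₂) * (b₁ - v₁) with hB
  set P := (b₁ - a₁) * (v₂ - a₂) - (b₂ - a₂) * (v₁ - a₁) with hP
  set Q := (b₁ - a₁) * (u₂ - a₂) - (b₂ - a₂) * (u₁ - a₁) with hQ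
  have iA : A ∈ intReals := sub_mem (mul_mem (sub_mem hu1 hv1) (sub_mem ha2 hv2))
    (mul_mem (sub_mem hu2 hv2) (sub_mem ha1 hv1))
  have iB : B ∈ intReals := sub_mem (mul_mem (sub_mem hu1 hv1) (sub_mem hb2 hv2))
    (mul_mem (sub_mem hu2 hv2) (sub_mem hb1 hv1))
  have iP : P ∈ intReals := sub_mem (mul_mem (sub_mem hb1 ha1) (sub_mem hv2 ha2))
    (mul_mem (sub_mem hb2 ha2) (sub_mem hv1 ha1))
  have iQ : Q ∈ intReals := sub_mem (mul_mem (sub_mem hb1 ha1) (sub_mem hu2 ha2))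
    (mul_mem (sub_mem hb2 ha2) (sub_mem hu1 ha1))
  have hAB : A * B ≤ 0 := by
    apply mul_nonpos_of_abs_convex_comb_lt_one iA iB hr.1 hr.2
    have := hcr _ _ hd1 hd2
    rw [← abs_neg] at this
    convert this using 2
    simp only [hA, hB, hδ1, hδ2]
    ring
  have hPQ : P * Q ≤ 0 := by
    apply mul_nonpos_of_abs_convex_comb_lt_one iP iQ hs.1 hs.2
    have := hcr _ _ he1 he2
    convert this using 2
    simp only [hP, hQ, hδ1, hδ2]
    ring
  have hN : Q - P = -(B - A) := by
    simp only [hA, hB, hP, hQ]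
    ring
  by_cases h0 : B - A = 0
  · have hBA : B = A := by linarith
    have hA0 : A = 0 := by
      rw [hBA] at hAB
      nlinarith [mul_self_nonneg A]
    have hB0 : B = 0 := by rw [hBA, hA0]
    have l1 : |δ₁| < 1 := by nlinarith [abs_nonneg δ₁]
    have l2 : |δ₂| < 1 := by nlinarith [abs_nonneg δ₂]
    rcases hne with hne | hne
    · exact exists_common_point_of_collinear hv1 hu1 ha1 hb1 hne hA0 hB0 hs hr l1
    · obtain ⟨s', hs', r', hr', e1, e2⟩ := exists_common_point_of_collinear
        (v₂ := v₁) (u₂ := u₁) (a₂ := a₁) (b₂ := b₁) hv2 hu2 ha2 hb2 hne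
        (by linarith) (by linarith) hs hr l2
      exact ⟨s', hs', r', hr', e2, e1⟩
  · refine ⟨_, neg_div_sub_mem_Icc hPQ (by rw [hN]; exact neg_ne_zero.2 h0), _,
      neg_div_sub_mem_Icc hAB h0, ?_, ?_⟩
    all_goals
      rw [hN]
      field_simp
      simp only [hA, hB, hP]
      ring

/-- The aperture (tangent of the half-angle) of the sector in direction `d`. -/
noncomputable def aperture (D : ℝ) (d : ℝ × ℝ) : ℝ := 1 / (30 * D * max |d.1| |d.2|)

/-- `q` lies in the cone of the given aperture around the direction `d`. -/
def InCone (t : ℝ) (d q : ℝ × ℝ) : Prop :=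
  |d.1 * q.2 - d.2 * q.1| ≤ t * (d.1 * q.1 + d.2 * q.2)

/-- The circular sector centered at `c`, in direction `d`, of aperture `t` and radius `ρ`. -/
def sectorAt (c d : ℝ × ℝ) (t ρ : ℝ) : Set (ℝ × ℝ) :=
  {p | InCone t d (p - c) ∧ (p.1 - c.1) ^ 2 + (p.2 - c.2) ^ 2 ≤ ρ ^ 2}

theorem isSector_sectorAt {c d : ℝ × ℝ} {t ρ : ℝ} (hd : d ≠ 0) (ht : 0 < t) (hρ : 0 < ρ) :
    IsSector c (sectorAt c d t ρ) := by
  set z : ℂ := ⟨d.1, d.2⟩ with hz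
  have hz0 : z ≠ 0 := by
    intro h
    apply hd
    have h1 := congrArg Complex.re h
    have h2 := congrArg Complex.im h
    exact Prod.ext h1 h2
  set N := ‖z‖ with hN
  have hNp : 0 < N := norm_pos_iff.2 hz0
  set θ := z.arg with hθ
  have hc : d.1 = N * cos θ := (Complex.norm_mul_cos_arg z).symm
  have hs : d.2 = N * sin θ := (Complex.norm_mul_sin_arg z).symm
  have hcs := Real.sin_sq_add_cos_sq θ
  have hφ : 0 < arctan t := Real.arctan_pos.2 ht
  have hφ2 := Real.arctan_lt_pi_div_two t
  refine ⟨ρ, θ - arctan t, θ + arctan t, hρ, by linarith, by linarith [Real.pi_pos], ?_⟩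
  ext p
  obtain ⟨p₁, p₂⟩ := p
  simp only [sectorAt, InCone, mem_ofPred_eq, Prod.fst_sub, Prod.snd_sub]
  constructor
  · rintro ⟨hcone, hrad⟩
    set X := (p₁ - c.1) * cos θ + (p₂ - c.2) * sin θ with hX
    set Y := (p₂ - c.2) * cos θ - (p₁ - c.1) * sin θ with hY
    have ecr : d.1 * (p₂ - c.2) - d.2 * (p₁ - c.1) = N * Y := by rw [hc, hs, hY]; ring
    have edot : d.1 * (p₁ - c.1) + d.2 * (p₂ - c.2) = N * X := by rw [hc, hs, hX]; ring
    rw [ecr, edot, abs_mul, abs_of_pos hNp] at hcone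
    have hYX : |Y| ≤ t * X := by
      apply le_of_mul_le_mul_left _ hNp
      linarith
    have hX0 : 0 ≤ X := by
      by_contra! hneg
      nlinarith [abs_nonneg Y]
    have e1 : p₁ - c.1 = X * cos θ - Y * sin θ := by
      rw [hX, hY]; linear_combination -(p₁ - c.1) * hcs
    have e2 : p₂ - c.2 = X * sin θ + Y * cos θ := by
      rw [hX, hY]; linear_combination -(p₂ - c.2) * hcs
    set α := arctan (Y / X) with hα
    have hcα : 0 < cos α := Real.cos_arctan_pos _
    have hXY : X * (sin α / cos α) = Y := by
      rw [← Real.tan_eq_sin_div_cos, hα, Real.tan_arctan]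
      rcases hX0.eq_or_lt with h | h
      · rw [← h] at hYX ⊢
        have : |Y| = 0 := le_antisymm (by simpa using hYX) (abs_nonneg _)
        rw [abs_eq_zero.1 this]; simp
      · field_simp
    have hle : |Y / X| ≤ t := by
      rcases hX0.eq_or_lt with h | h
      · rw [← h]; simpa using ht.le
      · rw [abs_div, abs_of_pos h, div_le_iff₀ h]; exact hYX
    obtain ⟨hl1, hl2⟩ := abs_le.1 hle
    have hα1 : α ≤ arctan t := Real.arctan_strictMono.monotone hl2
    have hα2 : -arctan t ≤ α := by
      rw [← Real.arctan_neg]; exact Real.arctan_strictMono.monotone hl1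
    have f1 : X / cos α * cos (θ + α) = p₁ - c.1 := by
      rw [Real.cos_add, e1, ← hXY]; field_simp
    have f2 : X / cos α * sin (θ + α) = p₂ - c.2 := by
      rw [Real.sin_add, e2, ← hXY]; field_simp
    refine ⟨X / cos α, θ + α, by positivity, ?_, by linarith, by linarith, ?_⟩
    · apply le_of_sq_le_sq _ hρ.le
      rw [← f1, ← f2] at hrad
      linear_combination hrad - (X / cos α) ^ 2 * Real.sin_sq_add_cos_sq (θ + α)
    · rw [f1, f2]; ext <;> simp
  · rintro ⟨r, β, hr0, hr1, hb1, hb2, hp⟩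
    obtain ⟨rfl, rfl⟩ := Prod.mk.inj hp
    set α := β - θ with hα
    have hβ : β = θ + α := by rw [hα]; ring
    have hm1 : α ∈ Ioo (-(π / 2)) (π / 2) := ⟨by linarith, by linarith⟩
    have hcα : 0 < cos α := Real.cos_pos_of_mem_Ioo hm1
    have ht1 : tan α ≤ t := by
      rw [← Real.tan_arctan t]
      exact Real.strictMonoOn_tan.monotoneOn hm1 ⟨by linarith, hφ2⟩ (by linarith)
    have ht2 : -t ≤ tan α := by
      rw [← Real.tan_arctan t, ← Real.tan_neg]
      exact Real.strictMonoOn_tan.monotoneOn ⟨by linarith, by linarith⟩ hm1 (by linarith)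
    rw [Real.tan_eq_sin_div_cos] at ht1 ht2
    rw [div_le_iff₀ hcα] at ht1
    rw [le_div_iff₀ hcα] at ht2
    have hrN : 0 ≤ N * r := by positivity
    constructor
    · have ecr : d.1 * (c.2 + r * sin β - c.2) - d.2 * (c.1 + r * cos β - c.1)
          = N * r * sin α := by
        rw [hc, hs, hα, Real.sin_sub]; ring
      have edot : d.1 * (c.1 + r * cos β - c.1) + d.2 * (c.2 + r * sin β - c.2)
          = N * r * cos α := by
        rw [hc, hs, hα, Real.cos_sub]; ring
      rw [ecr, edot, abs_mul, abs_of_nonneg hrN]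
      have : |sin α| ≤ t * cos α := abs_le.2 ⟨by linarith, ht1⟩
      nlinarith
    · have : (c.1 + r * cos β - c.1) ^ 2 + (c.2 + r * sin β - c.2) ^ 2 = r ^ 2 := by
        linear_combination r ^ 2 * Real.sin_sq_add_cos_sq β
      rw [this]
      exact pow_le_pow_left₀ hr0 hr1 2

theorem aperture_pos {D : ℝ} {d : ℝ × ℝ} (hD : 1 ≤ D) (hd : 1 ≤ max |d.1| |d.2|) :
    0 < aperture D d := by
  unfold aperture
  positivity

theorem aperture_mul {D : ℝ} {d : ℝ × ℝ} (hD : 1 ≤ D) (hd : 1 ≤ max |d.1| |d.2|) :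
    aperture D d * (30 * D * max |d.1| |d.2|) = 1 := by
  unfold aperture
  have : 0 < 30 * D * max |d.1| |d.2| := by positivity
  field_simp

theorem aperture_mul_max_le {D : ℝ} {d : ℝ × ℝ} (hD : 1 ≤ D) (hd : 1 ≤ max |d.1| |d.2|) :
    aperture D d * max |d.1| |d.2| ≤ 1 / 30 := by
  have h0 : 0 ≤ aperture D d * max |d.1| |d.2| :=
    mul_nonneg (aperture_pos hD hd).le (zero_le_one.trans hd)
  have h1 := aperture_mul hD hd
  have h2 := mul_le_mul_of_nonneg_left hD h0
  linarith

theorem aperture_le {D : ℝ} {d : ℝ × ℝ} (hD : 1 ≤ D) (hd : 1 ≤ max |d.1| |d.2|) :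
    aperture D d ≤ 1 / 30 :=
  (le_mul_of_one_le_right (aperture_pos hD hd).le hd).trans (aperture_mul_max_le hD hd)

theorem sq_max_le_sq_add_sq (x y : ℝ) : max |x| |y| ^ 2 ≤ x ^ 2 + y ^ 2 := by
  rcases max_choice |x| |y| with h | h <;> rw [h, sq_abs] <;> nlinarith [sq_nonneg x, sq_nonneg y]

theorem sq_add_sq_le_two_mul_sq_max (x y : ℝ) : x ^ 2 + y ^ 2 ≤ 2 * max |x| |y| ^ 2 := by
  have h1 := pow_le_pow_left₀ (abs_nonneg x) (le_max_left |x| |y|) 2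
  have h2 := pow_le_pow_left₀ (abs_nonneg y) (le_max_right |x| |y|) 2
  rw [sq_abs] at h1 h2
  linarith

theorem one_le_max_abs {x y : ℝ} (hx : x ∈ intReals) (hy : y ∈ intReals)
    (h : x ≠ 0 ∨ y ≠ 0) : 1 ≤ max |x| |y| := by
  by_contra! hc
  obtain ⟨h1, h2⟩ := max_lt_iff.1 hc
  rcases h with h | h
  · exact h (eq_zero_of_mem_intReals hx h1)
  · exact h (eq_zero_of_mem_intReals hy h2)

theorem dot_pos_of_inCone {t : ℝ} {d q : ℝ × ℝ} (ht : 0 < t) (hd : 1 ≤ max |d.1| |d.2|)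
    (hq : q ≠ 0) (h : InCone t d q) : 0 < d.1 * q.1 + d.2 * q.2 := by
  unfold InCone at h
  have hd2 : 0 < d.1 ^ 2 + d.2 ^ 2 := by nlinarith [sq_max_le_sq_add_sq d.1 d.2]
  by_contra! hneg
  have h0 : |d.1 * q.2 - d.2 * q.1| ≤ 0 := by nlinarith
  have hc : d.1 * q.2 - d.2 * q.1 = 0 := abs_eq_zero.1 (le_antisymm h0 (abs_nonneg _))
  have hdot : d.1 * q.1 + d.2 * q.2 = 0 := by
    have : 0 ≤ d.1 * q.1 + d.2 * q.2 := by
      have := (abs_nonneg _).trans h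
      exact nonneg_of_mul_nonneg_right this ht
    linarith
  apply hq
  ext
  · apply mul_left_cancel₀ hd2.ne'
    simp only [Prod.fst_zero]
    linear_combination d.1 * hdot - d.2 * hc
  · apply mul_left_cancel₀ hd2.ne'
    simp only [Prod.snd_zero]
    linear_combination d.2 * hdot + d.1 * hc

/-- If the cones around two bounded integer directions share a nonzero vector, then the two
directions are parallel and have positive inner product. -/
theorem cross_eq_zero_and_dot_pos_of_inCone {D : ℝ} {d e q : ℝ × ℝ} (hD : 1 ≤ D)
    (hd1 : d.1 ∈ intReals) (hd2 : d.2 ∈ intReals) (he1 : e.1 ∈ intReals) (he2 : e.2 ∈ intReals)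
    (hd : 1 ≤ max |d.1| |d.2|) (he : 1 ≤ max |e.1| |e.2|)
    (hdD : max |d.1| |d.2| ≤ D) (heD : max |e.1| |e.2| ≤ D) (hq : q ≠ 0)
    (hcd : InCone (aperture D d) d q) (hce : InCone (aperture D e) e q) :
    d.1 * e.2 - d.2 * e.1 = 0 ∧ 0 < d.1 * e.1 + d.2 * e.2 := by
  have ptd := dot_pos_of_inCone (aperture_pos hD hd) hd hq hcd
  have pte := dot_pos_of_inCone (aperture_pos hD he) he hq hce
  have td0 := aperture_pos hD hd
  have te0 := aperture_pos hD he
  have htm := aperture_mul_max_le hD hd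
  have htm' := aperture_mul_max_le hD he
  have t1 := aperture_le hD hd
  have t2 := aperture_le hD he
  have tdm := aperture_mul hD hd
  have tem := aperture_mul hD he
  set t := aperture D d
  set t' := aperture D e
  set m := max |d.1| |d.2| with hm
  set m' := max |e.1| |e.2| with hm'
  have bd := sq_add_sq_le_two_mul_sq_max d.1 d.2
  have be := sq_add_sq_le_two_mul_sq_max e.1 e.2
  rw [← hm] at bd
  rw [← hm'] at be
  unfold InCone at hcd hce
  set X := d.1 * q.1 + d.2 * q.2 with hX
  set X' := e.1 * q.1 + e.2 * q.2 with hX'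
  set Y := d.1 * q.2 - d.2 * q.1 with hY
  set Y' := e.1 * q.2 - e.2 * q.1 with hY'
  set R := q.1 ^ 2 + q.2 ^ 2 with hR
  have hRp : 0 < R := by
    rcases eq_or_ne q.1 0 with h | h
    · have : q.2 ≠ 0 := fun h' => hq (Prod.ext h h')
      positivity
    · positivity
  have ecr : (d.1 * e.2 - d.2 * e.1) * R = Y * X' - X * Y' := by
    simp only [hX, hX', hY, hY', hR]; ring
  have edot : (d.1 * e.1 + d.2 * e.2) * R = X * X' + Y * Y' := by
    simp only [hX, hX', hY, hY', hR]; ring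
  have hXX : X * X' ≤ 2 * m * m' * R := by
    have l1 : X ^ 2 ≤ 2 * m ^ 2 * R := by
      have : X ^ 2 + Y ^ 2 = (d.1 ^ 2 + d.2 ^ 2) * R := by simp only [hX, hY, hR]; ring
      nlinarith [sq_nonneg Y]
    have l2 : X' ^ 2 ≤ 2 * m' ^ 2 * R := by
      have : X' ^ 2 + Y' ^ 2 = (e.1 ^ 2 + e.2 ^ 2) * R := by simp only [hX', hY', hR]; ring
      nlinarith [sq_nonneg Y']
    apply le_of_sq_le_sq _ (by positivity)
    calc (X * X') ^ 2 = X ^ 2 * X' ^ 2 := by ring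
      _ ≤ (2 * m ^ 2 * R) * (2 * m' ^ 2 * R) := by gcongr
      _ = (2 * m * m' * R) ^ 2 := by ring
  have hXp : 0 < X * X' := mul_pos ptd pte
  have hsum : (t + t') * (2 * m * m') < 1 := by
    have a1 := mul_le_mul_of_nonneg_left heD (by positivity : 0 ≤ t * m)
    have a2 := mul_le_mul_of_nonneg_left hdD (by positivity : 0 ≤ t' * m')
    linarith
  constructor
  · apply eq_zero_of_mem_intReals (sub_mem (mul_mem hd1 he2) (mul_mem hd2 he1))
    apply lt_of_mul_lt_mul_right _ hRp.le
    calc |d.1 * e.2 - d.2 * e.1| * R = |(d.1 * e.2 - d.2 * e.1) * R| := by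
          rw [abs_mul, abs_of_pos hRp]
      _ = |Y * X' - X * Y'| := by rw [ecr]
      _ ≤ |Y| * X' + X * |Y'| := by
          refine (abs_sub _ _).trans_eq ?_
          rw [abs_mul, abs_mul, abs_of_pos ptd, abs_of_pos pte]
      _ ≤ (t * X) * X' + X * (t' * X') := by gcongr
      _ = (t + t') * (X * X') := by ring
      _ ≤ (t + t') * (2 * m * m' * R) := by gcongr
      _ = (t + t') * (2 * m * m') * R := by ring
      _ < 1 * R := by gcongr
  · apply pos_of_mul_pos_left _ hRp.le
    rw [edot]
    have : |Y * Y'| ≤ 1 / 900 * (X * X') := by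
      rw [abs_mul]
      calc |Y| * |Y'| ≤ (t * X) * (t' * X') := by gcongr
        _ = t * t' * (X * X') := by ring
        _ ≤ (1 / 30) * (1 / 30) * (X * X') := by gcongr
        _ = _ := by ring
    linarith [(abs_le.1 this).1]

theorem exists_smul_eq_smul_of_inCone {D : ℝ} {d e q : ℝ × ℝ} (hD : 1 ≤ D)
    (hd1 : d.1 ∈ intReals) (hd2 : d.2 ∈ intReals) (he1 : e.1 ∈ intReals) (he2 : e.2 ∈ intReals)
    (hd : 1 ≤ max |d.1| |d.2|) (he : 1 ≤ max |e.1| |e.2|)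
    (hdD : max |d.1| |d.2| ≤ D) (heD : max |e.1| |e.2| ≤ D) (hq : q ≠ 0)
    (hcd : InCone (aperture D d) d q) (hce : InCone (aperture D e) e q) :
    ∃ s ∈ Icc (0 : ℝ) 1, ∃ r ∈ Icc (0 : ℝ) 1, s ≠ 0 ∧ s • d = r • e := by
  obtain ⟨hcr0, hdotp⟩ :=
    cross_eq_zero_and_dot_pos_of_inCone hD hd1 hd2 he1 he2 hd he hdD heD hq hcd hce
  have hd2p : 0 < d.1 ^ 2 + d.2 ^ 2 := by nlinarith [sq_max_le_sq_add_sq d.1 d.2]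
  set P := d.1 * e.1 + d.2 * e.2 with hP
  set Q := d.1 ^ 2 + d.2 ^ 2 with hQ
  have f1 : P * d.1 = Q * e.1 := by rw [hP, hQ]; linear_combination d.2 * hcr0
  have f2 : P * d.2 = Q * e.2 := by rw [hP, hQ]; linear_combination -d.1 * hcr0
  have hM : 0 < P + Q := by linarith
  refine ⟨P / (P + Q), ⟨by positivity, by rw [div_le_one hM]; linarith⟩, Q / (P + Q),
    ⟨by positivity, by rw [div_le_one hM]; linarith⟩, by positivity, ?_⟩
  ext <;> simp only [Prod.smul_fst, Prod.smul_snd, smul_eq_mul]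
  · rw [div_mul_eq_mul_div, div_mul_eq_mul_div, f1]
  · rw [div_mul_eq_mul_div, div_mul_eq_mul_div, f2]

/-- A vector of a thin sector in direction `d` is close to the segment from `0` to `B • d`. -/
theorem exists_near_of_inCone {D B : ℝ} {d q : ℝ × ℝ} (hD : 1 ≤ D) (hB : 0 < B)
    (hd : 1 ≤ max |d.1| |d.2|) (hc : InCone (aperture D d) d q)
    (hr : q.1 ^ 2 + q.2 ^ 2 ≤ (B * (1 + aperture D d)) ^ 2 * (d.1 ^ 2 + d.2 ^ 2)) :
    ∃ s ∈ Icc (0 : ℝ) 1,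
      10 * D * |q.1 - B * s * d.1| ≤ B ∧ 10 * D * |q.2 - B * s * d.2| ≤ B := by
  have t0 := aperture_pos hD hd
  have tm := aperture_mul hD hd
  have ht1 := aperture_le hD hd
  have htm := aperture_mul_max_le hD hd
  set t := aperture D d
  set m := max |d.1| |d.2| with hm
  have m1 : |d.1| ≤ m := le_max_left _ _
  have m2 : |d.2| ≤ m := le_max_right _ _
  have hsq := sq_max_le_sq_add_sq d.1 d.2
  rw [← hm] at hsq
  unfold InCone at hc
  set X := d.1 * q.1 + d.2 * q.2 with hX
  set Y := d.1 * q.2 - d.2 * q.1 with hY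
  set N := d.1 ^ 2 + d.2 ^ 2 with hN
  have hNp : 0 < N := by nlinarith
  set τ := X / (B * N) with hτ
  have hBN : 0 < B * N := by positivity
  have hX0 : 0 ≤ X := nonneg_of_mul_nonneg_right ((abs_nonneg _).trans hc) t0
  have τ0 : 0 ≤ τ := by positivity
  have hXτ : X = τ * (B * N) := by rw [hτ]; field_simp
  have hτ1 : τ ≤ 1 + t := by
    have h1 : X ^ 2 ≤ (B * (1 + t) * N) ^ 2 := by
      have : X ^ 2 + Y ^ 2 = N * (q.1 ^ 2 + q.2 ^ 2) := by simp only [hX, hY, hN]; ring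
      calc X ^ 2 ≤ N * (q.1 ^ 2 + q.2 ^ 2) := by nlinarith [sq_nonneg Y]
        _ ≤ N * ((B * (1 + t)) ^ 2 * N) := by gcongr
        _ = _ := by ring
    have h2 : X ≤ B * (1 + t) * N := le_of_sq_le_sq h1 (by positivity)
    rw [hτ, div_le_iff₀ hBN]
    linarith
  have e1 : N * (q.1 - B * τ * d.1) = -Y * d.2 := by
    have : N * q.1 = X * d.1 - Y * d.2 := by simp only [hX, hY, hN]; ring
    linear_combination this + d.1 * hXτ
  have e2 : N * (q.2 - B * τ * d.2) = Y * d.1 := by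
    have : N * q.2 = X * d.2 + Y * d.1 := by simp only [hX, hY, hN]; ring
    linear_combination this + d.2 * hXτ
  have hYm : |Y| * m ≤ N * (B * τ * t * m) := by
    calc |Y| * m ≤ t * X * m := by gcongr
      _ = _ := by rw [hXτ]; ring
  have p1 : |q.1 - B * τ * d.1| ≤ B * τ * t * m := by
    apply le_of_mul_le_mul_left _ hNp
    calc N * |q.1 - B * τ * d.1| = |N * (q.1 - B * τ * d.1)| := by rw [abs_mul, abs_of_pos hNp]
      _ = |Y| * |d.2| := by rw [e1, abs_mul, abs_neg]
      _ ≤ |Y| * m := by gcongr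
      _ ≤ _ := hYm
  have p2 : |q.2 - B * τ * d.2| ≤ B * τ * t * m := by
    apply le_of_mul_le_mul_left _ hNp
    calc N * |q.2 - B * τ * d.2| = |N * (q.2 - B * τ * d.2)| := by rw [abs_mul, abs_of_pos hNp]
      _ = |Y| * |d.1| := by rw [e2, abs_mul]
      _ ≤ |Y| * m := by gcongr
      _ ≤ _ := hYm
  have htD : t * m * D = 1 / 30 := by linarith
  rcases le_total τ 1 with h | h
  · have key : 10 * D * (B * τ * t * m) ≤ B := by
      calc 10 * D * (B * τ * t * m) = 10 * (t * m * D) * (τ * B) := by ring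
        _ ≤ B := by rw [htD]; nlinarith
    exact ⟨τ, ⟨τ0, h⟩, le_trans (by gcongr) key, le_trans (by gcongr) key⟩
  · have key : 10 * D * (B * τ * t * m + B * t * m) ≤ B := by
      calc 10 * D * (B * τ * t * m + B * t * m) = 10 * (t * m * D) * ((τ + 1) * B) := by ring
        _ ≤ B := by rw [htD]; nlinarith
    have shift : ∀ x y : ℝ, |y| ≤ m → |x - B * τ * y| ≤ B * τ * t * m →
        |x - B * 1 * y| ≤ B * τ * t * m + B * t * m := by
      intro x y hy hxy
      have : |B * (τ - 1) * y| ≤ B * t * m := by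
        rw [abs_mul, abs_of_nonneg (mul_nonneg hB.le (by linarith))]
        gcongr
        linarith
      calc |x - B * 1 * y| = |(x - B * τ * y) + B * (τ - 1) * y| := by congr 1; ring
        _ ≤ _ := (abs_add_le _ _).trans (add_le_add hxy this)
    refine ⟨1, ⟨zero_le_one, le_rfl⟩, le_trans ?_ key, le_trans ?_ key⟩
    · exact mul_le_mul_of_nonneg_left (shift _ _ m1 p1) (by positivity)
    · exact mul_le_mul_of_nonneg_left (shift _ _ m2 p2) (by positivity)

/-- The cone contains a box centered at a sufficiently far point of its axis. -/
theorem inCone_of_mem_box {D n k : ℝ} {d q : ℝ × ℝ} (hD : 1 ≤ D) (hn : 0 < n)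
    (hd : 1 ≤ max |d.1| |d.2|) (hk : 70 * D * n ≤ k)
    (h1 : |q.1 - k * d.1| ≤ n) (h2 : |q.2 - k * d.2| ≤ n) : InCone (aperture D d) d q := by
  have t0 := aperture_pos hD hd
  have tm := aperture_mul hD hd
  have ht1 := aperture_le hD hd
  have htm := aperture_mul_max_le hD hd
  set t := aperture D d
  set m := max |d.1| |d.2| with hm
  have m1 : |d.1| ≤ m := le_max_left _ _
  have m2 : |d.2| ≤ m := le_max_right _ _
  have hsq := sq_max_le_sq_add_sq d.1 d.2
  rw [← hm] at hsq
  set x := q.1 - k * d.1 with hx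
  set y := q.2 - k * d.2 with hy
  have ecr : d.1 * q.2 - d.2 * q.1 = d.1 * y - d.2 * x := by rw [hx, hy]; ring
  have edot : d.1 * q.1 + d.2 * q.2 = k * (d.1 ^ 2 + d.2 ^ 2) + (d.1 * x + d.2 * y) := by
    rw [hx, hy]; ring
  have b1 : |d.1 * y - d.2 * x| ≤ 2 * m * n := by
    refine (abs_sub _ _).trans ?_
    rw [abs_mul, abs_mul]
    have := mul_le_mul m1 h2 (abs_nonneg _) (by linarith)
    have := mul_le_mul m2 h1 (abs_nonneg _) (by linarith)
    linarith
  have b2 : |d.1 * x + d.2 * y| ≤ 2 * m * n := by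
    refine (abs_add_le _ _).trans ?_
    rw [abs_mul, abs_mul]
    have := mul_le_mul m1 h1 (abs_nonneg _) (by linarith)
    have := mul_le_mul m2 h2 (abs_nonneg _) (by linarith)
    linarith
  unfold InCone
  rw [ecr, edot]
  refine b1.trans ?_
  have hk2 : 70 * D * n * m ^ 2 ≤ k * (d.1 ^ 2 + d.2 ^ 2) := by
    have : 0 ≤ 70 * D * n := by positivity
    calc 70 * D * n * m ^ 2 ≤ 70 * D * n * (d.1 ^ 2 + d.2 ^ 2) := by gcongr
      _ ≤ _ := by gcongr
  calc 2 * m * n ≤ 70 / 30 * m * n - 2 * (1 / 30) * n := by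
        linarith [mul_le_mul_of_nonneg_right hd hn.le]
    _ ≤ 70 / 30 * m * n - 2 * (t * m) * n := by gcongr
    _ = t * (70 * D * n * m ^ 2 + -(2 * m * n)) := by linear_combination (-(70 / 30) * m * n) * tm
    _ ≤ _ := by
        gcongr
        exact (abs_le.1 b2).1

theorem sq_add_sq_le_of_mem_box {D n k B : ℝ} {d q : ℝ × ℝ} (hD : 1 ≤ D) (hn : 0 < n)
    (hd : 1 ≤ max |d.1| |d.2|) (hk0 : 0 ≤ k) (hkB : k ≤ B) (hB : 800 * D * n ≤ B)
    (h1 : |q.1 - k * d.1| ≤ n) (h2 : |q.2 - k * d.2| ≤ n) :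
    q.1 ^ 2 + q.2 ^ 2 ≤ (B * (1 + aperture D d)) ^ 2 * (d.1 ^ 2 + d.2 ^ 2) := by
  have t0 := aperture_pos hD hd
  have tm := aperture_mul hD hd
  have ht1 := aperture_le hD hd
  have htm := aperture_mul_max_le hD hd
  set t := aperture D d
  set m := max |d.1| |d.2| with hm
  have m1 : |d.1| ≤ m := le_max_left _ _
  have m2 : |d.2| ≤ m := le_max_right _ _
  have hsq := sq_max_le_sq_add_sq d.1 d.2
  rw [← hm] at hsq
  set x := q.1 - k * d.1 with hx
  set y := q.2 - k * d.2 with hy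
  set N := d.1 ^ 2 + d.2 ^ 2 with hN
  have hN0 : 0 ≤ N := by positivity
  have hB0 : 0 < B := by nlinarith
  have b2 : |d.1 * x + d.2 * y| ≤ 2 * m * n := by
    refine (abs_add_le _ _).trans ?_
    rw [abs_mul, abs_mul]
    have := mul_le_mul m1 h1 (abs_nonneg _) (by linarith)
    have := mul_le_mul m2 h2 (abs_nonneg _) (by linarith)
    linarith
  have x2 : x ^ 2 ≤ n ^ 2 := by rw [← sq_abs x]; gcongr
  have y2 : y ^ 2 ≤ n ^ 2 := by rw [← sq_abs y]; gcongr
  have hnB : n ≤ B := by nlinarith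
  calc q.1 ^ 2 + q.2 ^ 2 = k ^ 2 * N + 2 * k * (d.1 * x + d.2 * y) + (x ^ 2 + y ^ 2) := by
        rw [hx, hy, hN]; ring
    _ ≤ B ^ 2 * N + 2 * B * (2 * m * n) + (n ^ 2 + n ^ 2) := by
        have : k * (d.1 * x + d.2 * y) ≤ B * (2 * m * n) := by
          have l := mul_le_mul_of_nonneg_left ((le_abs_self _).trans b2) hk0
          refine l.trans ?_
          gcongr
        have : k ^ 2 * N ≤ B ^ 2 * N := by gcongr
        linarith
    _ ≤ B ^ 2 * N + 6 * B * m * n := by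
        have : n ^ 2 ≤ B * m * n := by
          calc n ^ 2 = n * 1 * n := by ring
            _ ≤ B * m * n := by gcongr
        linarith
    _ ≤ B ^ 2 * N + 2 * t * B ^ 2 * m ^ 2 := by
        have : 800 * n ≤ 30 * (t * B * m) := by
          apply le_of_mul_le_mul_right _ (by linarith : 0 < D)
          calc 800 * n * D ≤ B := by linarith
            _ = _ := by linear_combination (-B) * tm
        have : 3 * n ≤ t * B * m := by linarith
        have := mul_le_mul_of_nonneg_left this (by positivity : 0 ≤ 2 * (B * m))
        linarith
    _ ≤ B ^ 2 * N + 2 * t * B ^ 2 * N + t ^ 2 * B ^ 2 * N := by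
        have : 2 * t * B ^ 2 * m ^ 2 ≤ 2 * t * B ^ 2 * N := by gcongr
        have : 0 ≤ t ^ 2 * B ^ 2 * N := by positivity
        linarith
    _ = _ := by ring


namespace OTree

theorem AncEq.refl (T : OTree V) (u : V) : T.AncEq u u := ⟨0, rfl⟩

theorem parent_iterate_of_parent_parent_eq (T : OTree V) {u : V}
    (h : T.parent (T.parent u) = u) (n : ℕ) :
    T.parent^[n] u = u ∨ T.parent^[n] u = T.parent u := by
  induction n with
  | zero => exact Or.inl rfl
  | succ n ih =>
    rw [Function.iterate_succ_apply']
    rcases ih with ih | ih <;> rw [ih]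
    · exact Or.inr rfl
    · exact Or.inl h

theorem parent_parent_ne (T : OTree V) {u : V} (hu : u ≠ T.root) :
    T.parent (T.parent u) ≠ u := by
  intro h
  obtain ⟨n, hn⟩ := T.reach u
  rcases T.parent_iterate_of_parent_parent_eq h n with h' | h'
  · exact hu (h'.symm.trans hn)
  · have h2 : T.parent u = T.root := h'.symm.trans hn
    rw [h2, T.parent_root] at h
    exact hu h.symm

theorem parent_ne (T : OTree V) {u : V} (hu : u ≠ T.root) : T.parent u ≠ u := fun h =>
  T.parent_parent_ne hu (by rw [h, h])

theorem exists_child_root (T : OTree V) {u : V} (hu : u ≠ T.root) :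
    ∃ c, T.IsChild c T.root := by
  obtain ⟨n, hn⟩ := T.reach u
  induction n generalizing u with
  | zero => exact absurd hn hu
  | succ n ih =>
    by_cases h : T.parent u = T.root
    · exact ⟨u, hu, h⟩
    · exact ih h hn

theorem IsLeaf.eq_of_ancEq {T : OTree V} {u w : V} (hu : T.IsLeaf u) (h : T.AncEq u w) :
    w = u := by
  obtain ⟨n, hn⟩ := h
  induction n generalizing w with
  | zero => exact hn
  | succ n ih =>
    have hp : T.parent w = u := ih hn
    by_cases hw : w = T.root
    · rw [hw, T.parent_root] at hp
      rw [hw, hp]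
    · exact absurd ⟨hw, hp⟩ (hu w)

end OTree

theorem IsGridD.fst_mem {ι : Type} {Γ : ι → ℝ × ℝ} (h : IsGridD Γ) (v : ι) : (Γ v).1 ∈ intReals :=
  mem_intReals_iff.2 (h v).1

theorem IsGridD.snd_mem {ι : Type} {Γ : ι → ℝ × ℝ} (h : IsGridD Γ) (v : ι) : (Γ v).2 ∈ intReals :=
  mem_intReals_iff.2 (h v).2

theorem abs_sub_le_sSup_range_sub_sInf_range {ι : Type} [Finite ι] (f : ι → ℝ) (v w : ι) :
    |f v - f w| ≤ sSup (range f) - sInf (range f) := by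
  have hf := finite_range f
  have ha := fun x => le_csSup hf.bddAbove (mem_range_self (f := f) x)
  have hb := fun x => csInf_le hf.bddBelow (mem_range_self (f := f) x)
  rw [abs_le]
  constructor <;> linarith [ha v, ha w, hb v, hb w]

theorem sSup_range_sub_sInf_range_mem {ι : Type} [Finite ι] [Nonempty ι] {f : ι → ℝ} (h : ∀ v, f v ∈ intReals) :
    sSup (range f) - sInf (range f) ∈ intReals := by
  have hf := finite_range f
  obtain ⟨a, ha⟩ := (range_nonempty f).csSup_mem hf
  obtain ⟨b, hb⟩ := (range_nonempty f).csInf_mem hf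
  rw [← ha, ← hb]
  exact sub_mem (h a) (h b)

theorem exists_eq_smul_of_mem_segment_smul {B : ℝ} {x y z : ℝ × ℝ}
    (h : z ∈ segment ℝ (B • x) (B • y)) : ∃ z' ∈ segment ℝ x y, z = B • z' := by
  obtain ⟨a, b, ha, hb, hab, rfl⟩ := h
  refine ⟨a • x + b • y, ⟨a, b, ha, hb, hab, rfl⟩, ?_⟩
  rw [smul_add, smul_comm B a, smul_comm B b]

theorem IsOrderPreservingD.smul {T : OTree V} {Γ : V → ℝ × ℝ} (h : IsOrderPreservingD T Γ)
    {B : ℝ} (hB : 0 < B) : IsOrderPreservingD T (fun v => B • Γ v) := by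
  have e : ∀ a v w, angFrom (fun v => B • Γ v) a v w = angFrom Γ a v w := by
    intro a v w
    have : dirAngle (B • Γ v) (B • Γ w) = dirAngle (Γ v) (Γ w) := by
      unfold dirAngle
      refine (congrArg Complex.arg ?_).trans (Complex.arg_real_mul _ hB)
      simp only [Prod.smul_fst, Prod.smul_snd, smul_eq_mul]
      push_cast
      ring
    simp only [angFrom, this]
  intro v
  simpa only [e] using h v

theorem IsPlanarD.smul {T : OTree V} {Γ : V → ℝ × ℝ} (h : IsPlanarD T Γ)
    {B : ℝ} (hB : 0 < B) : IsPlanarD T (fun v => B • Γ v) := by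
  refine ⟨fun v w hvw => h.1 (smul_right_injective _ hB.ne' hvw), ?_⟩
  rintro u v hu hv huv z ⟨h1, h2⟩
  obtain ⟨z₁, hz₁, rfl⟩ := exists_eq_smul_of_mem_segment_smul h1
  obtain ⟨z₂, hz₂, e⟩ := exists_eq_smul_of_mem_segment_smul h2
  obtain rfl := smul_right_injective _ hB.ne' e
  obtain ⟨w, hw, rfl⟩ := h.2 u v hu hv huv ⟨hz₁, hz₂⟩
  exact ⟨w, hw, rfl⟩

theorem IsGridD.smul {ι : Type} {Γ : ι → ℝ × ℝ} (h : IsGridD Γ) {B : ℝ} (hB : B ∈ intReals) :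
    IsGridD (fun v => B • Γ v) := fun v =>
  ⟨mem_intReals_iff.1 (mul_mem hB (h.fst_mem v)), mem_intReals_iff.1 (mul_mem hB (h.snd_mem v))⟩

theorem OTree.IsLeaf.upCanonicalOn {T : OTree V} {Γ : V → ℝ × ℝ} (h : IsGridD Γ) {u : V}
    (hu : T.IsLeaf u) : UpCanonicalOn T u Γ := by
  obtain ⟨⟨a, ha⟩, ⟨b, hb⟩⟩ := h u
  refine ⟨a - relIdx T u u, b, fun w hw => ?_⟩
  obtain rfl := hu.eq_of_ancEq hw
  ext <;> simp [ha, hb]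

theorem OTree.IsLeaf.downCanonicalOn {T : OTree V} {Γ : V → ℝ × ℝ} (h : IsGridD Γ) {u : V}
    (hu : T.IsLeaf u) : DownCanonicalOn T u Γ := by
  refine ⟨fun v => -Γ v, hu.upCanonicalOn fun v => ?_, fun w _ => by simp [rotCCW]⟩
  obtain ⟨⟨a, ha⟩, ⟨b, hb⟩⟩ := h v
  exact ⟨⟨-a, by simp [ha]⟩, ⟨-b, by simp [hb]⟩⟩

theorem IsPlanarD.not_mem_segment {T : OTree V} {Γ : V → ℝ × ℝ} (h : IsPlanarD T Γ) {u w : V}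
    (hu : u ≠ T.root) (hwu : w ≠ u) (hwp : w ≠ T.parent u) :
    Γ w ∉ segment ℝ (Γ u) (Γ (T.parent u)) := by
  intro hmem
  have key : ∀ c, c ≠ T.root → u ≠ c → Γ w ∈ segment ℝ (Γ c) (Γ (T.parent c)) → False := by
    intro c hc huc hm
    obtain ⟨z, ⟨hz, -⟩, e⟩ := h.2 u c hu hc huc ⟨hmem, hm⟩
    obtain rfl := h.1 e
    rcases hz with hz | hz
    · exact hwu hz
    · exact hwp hz
  by_cases hw : w = T.root
  · obtain ⟨c, hc, hcp⟩ := T.exists_child_root hu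
    refine key c hc ?_ ?_
    · rintro rfl
      exact hwp (hw.trans hcp.symm)
    · rw [hcp, ← hw]
      exact right_mem_segment ℝ _ _
  · exact key w hw hwu.symm (left_mem_segment ℝ _ _)

theorem mem_segment_iff_exists_smul {x y z : ℝ × ℝ} :
    z ∈ segment ℝ x y ↔ ∃ s ∈ Icc (0 : ℝ) 1, x + s • (y - x) = z := by
  rw [segment_eq_image']
  rfl

theorem IsGridD.segment_inter_nonempty {ι : Type} {Γ : ι → ℝ × ℝ} (hgr : IsGridD Γ) {D : ℝ} (hD : 1 ≤ D)
    (hx : ∀ v w, |(Γ v).1 - (Γ w).1| ≤ D) (hy : ∀ v w, |(Γ v).2 - (Γ w).2| ≤ D)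
    {u v a b : ι} (hne : Γ u ≠ Γ v) {x y : ℝ × ℝ}
    (hxs : x ∈ segment ℝ (Γ v) (Γ u)) (hys : y ∈ segment ℝ (Γ a) (Γ b))
    (h1 : 2 * D * |x.1 - y.1| < 1) (h2 : 2 * D * |x.2 - y.2| < 1) :
    (segment ℝ (Γ v) (Γ u) ∩ segment ℝ (Γ a) (Γ b)).Nonempty := by
  obtain ⟨s, hs, rfl⟩ := mem_segment_iff_exists_smul.1 hxs
  obtain ⟨r, hr, rfl⟩ := mem_segment_iff_exists_smul.1 hys
  have hne' : (Γ u).1 - (Γ v).1 ≠ 0 ∨ (Γ u).2 - (Γ v).2 ≠ 0 := by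
    by_contra! hc
    exact hne (Prod.ext (sub_eq_zero.1 hc.1) (sub_eq_zero.1 hc.2))
  obtain ⟨s', hs', r', hr', e1, e2⟩ := exists_common_point_of_close hD
    (hgr.fst_mem v) (hgr.snd_mem v) (hgr.fst_mem u) (hgr.snd_mem u)
    (hgr.fst_mem a) (hgr.snd_mem a) (hgr.fst_mem b) (hgr.snd_mem b) hne'
    (hx u v) (hy u v) (hx b a) (hy b a) hs hr h1 h2
  exact ⟨Γ v + s' • (Γ u - Γ v), mem_segment_iff_exists_smul.2 ⟨s', hs', rfl⟩,
    mem_segment_iff_exists_smul.2 ⟨r', hr', (Prod.ext e1 e2).symm⟩⟩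

/-- `p` is within sup-distance `B / (10 D)` of `B • x`. -/
def NearScaled (D B : ℝ) (p x : ℝ × ℝ) : Prop :=
  10 * D * |p.1 - B * x.1| ≤ B ∧ 10 * D * |p.2 - B * x.2| ≤ B

theorem nearScaled_smul {D B : ℝ} (hB : 0 < B) (x : ℝ × ℝ) : NearScaled D B (B • x) x := by
  simp [NearScaled, hB.le]

theorem NearScaled.close {D B : ℝ} {p x y : ℝ × ℝ} (hD : 1 ≤ D) (hB : 0 < B)
    (hx : NearScaled D B p x) (hy : NearScaled D B p y) :
    2 * D * |x.1 - y.1| < 1 ∧ 2 * D * |x.2 - y.2| < 1 := by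
  have aux : ∀ p x y : ℝ, 10 * D * |p - B * x| ≤ B → 10 * D * |p - B * y| ≤ B →
      2 * D * |x - y| < 1 := by
    intro p x y h1 h2
    have h3 : B * |x - y| ≤ |p - B * x| + |p - B * y| := by
      calc B * |x - y| = |(p - B * y) - (p - B * x)| := by
            rw [← abs_of_pos hB, ← abs_mul, abs_of_pos hB]; congr 1; ring
        _ ≤ |p - B * y| + |p - B * x| := abs_sub _ _
        _ = _ := add_comm _ _
    have h4 := mul_le_mul_of_nonneg_left h3 (by linarith : 0 ≤ 10 * D)
    have h5 : B * (10 * D * |x - y|) ≤ B * 2 := by linarith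
    have h6 := le_of_mul_le_mul_left h5 hB
    linarith
  exact ⟨aux _ _ _ hx.1 hy.1, aux _ _ _ hx.2 hy.2⟩

theorem NearScaled.of_mem_boxAt {D n : ℝ} {p x : ℝ × ℝ} (hD : 1 ≤ D) (hn : 0 < n)
    (h : p ∈ boxAt (150 * D ^ 2 * n + 4 * n) ((800 * D ^ 3 * n) • x)) :
    NearScaled D (800 * D ^ 3 * n) p x := by
  obtain ⟨h1, h2⟩ := h
  simp only [Prod.smul_fst, Prod.smul_snd, smul_eq_mul] at h1 h2
  have hD3 : D ≤ D ^ 3 := le_self_pow₀ hD (by norm_num)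
  have hb : 10 * D * ((150 * D ^ 2 * n + 4 * n) / 2) ≤ 800 * D ^ 3 * n := by
    have := mul_le_mul_of_nonneg_right hD3 hn.le
    have : 0 ≤ D ^ 3 * n := by positivity
    calc 10 * D * ((150 * D ^ 2 * n + 4 * n) / 2) = 750 * (D ^ 3 * n) + 20 * (D * n) := by ring
      _ ≤ 800 * D ^ 3 * n := by linarith
  have h0 : 0 ≤ 10 * D := by linarith
  exact ⟨(mul_le_mul_of_nonneg_left h1 h0).trans hb, (mul_le_mul_of_nonneg_left h2 h0).trans hb⟩

/-- The sector of the edge from `u` to its parent in the drawing `Γ` scaled up by `B`. -/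
noncomputable def edgeSector (T : OTree V) (Γ : V → ℝ × ℝ) (D B : ℝ) (u : V) : Set (ℝ × ℝ) :=
  let d := Γ u - Γ (T.parent u)
  sectorAt (B • Γ (T.parent u)) d (aperture D d)
    (B * (1 + aperture D d) * √(d.1 ^ 2 + d.2 ^ 2))

theorem sq_mul_sqrt_sq_add_sq (a x y : ℝ) :
    (a * √(x ^ 2 + y ^ 2)) ^ 2 = a ^ 2 * (x ^ 2 + y ^ 2) := by
  rw [mul_pow, Real.sq_sqrt (by positivity)]

section Drawing

variable {T : OTree V} {Γ : V → ℝ × ℝ} {D B : ℝ}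

theorem IsGridD.one_le_max_abs_sub {ι : Type} {Γ : ι → ℝ × ℝ} (hgr : IsGridD Γ)
    {u v : ι} (h : Γ u ≠ Γ v) :
    1 ≤ max |(Γ u - Γ v).1| |(Γ u - Γ v).2| := by
  apply one_le_max_abs (sub_mem (hgr.fst_mem u) (hgr.fst_mem v))
    (sub_mem (hgr.snd_mem u) (hgr.snd_mem v))
  by_contra! hc
  exact h (Prod.ext (sub_eq_zero.1 hc.1) (sub_eq_zero.1 hc.2))

theorem exists_nearScaled_of_mem_edgeSector (hgr : IsGridD Γ) (hinj : Function.Injective Γ)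
    (hD : 1 ≤ D) (hB : 0 < B) {u : V} (hu : u ≠ T.root) {p : ℝ × ℝ}
    (hp : p ∈ edgeSector T Γ D B u) :
    ∃ x ∈ segment ℝ (Γ (T.parent u)) (Γ u), NearScaled D B p x := by
  obtain ⟨hc, hr⟩ := hp
  rw [sq_mul_sqrt_sq_add_sq] at hr
  have hd := hgr.one_le_max_abs_sub (hinj.ne (T.parent_ne hu).symm)
  obtain ⟨s, hs, e1, e2⟩ := exists_near_of_inCone hD hB hd hc hr
  refine ⟨_, mem_segment_iff_exists_smul.2 ⟨s, hs, rfl⟩, ?_, ?_⟩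
  · convert e1 using 3
    simp only [Prod.fst_add, Prod.smul_fst, Prod.fst_sub, smul_eq_mul]
    ring
  · convert e2 using 3
    simp only [Prod.snd_add, Prod.smul_snd, Prod.snd_sub, smul_eq_mul]
    ring

theorem IsPlanarD.not_nearScaled_of_mem_segment (hpl : IsPlanarD T Γ) (hgr : IsGridD Γ)
    (hD : 1 ≤ D) (hB : 0 < B)
    (hx : ∀ v w, |(Γ v).1 - (Γ w).1| ≤ D) (hy : ∀ v w, |(Γ v).2 - (Γ w).2| ≤ D)
    {u w : V} (hu : u ≠ T.root) (hwu : w ≠ u) (hwp : w ≠ T.parent u) {p x : ℝ × ℝ}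
    (hxs : x ∈ segment ℝ (Γ (T.parent u)) (Γ u)) (hpx : NearScaled D B p x) :
    ¬ NearScaled D B p (Γ w) := by
  intro hpw
  obtain ⟨h1, h2⟩ := hpx.close hD hB hpw
  obtain ⟨z, hz1, hz2⟩ := hgr.segment_inter_nonempty hD hx hy (a := w) (b := w)
    (hpl.1.ne (T.parent_ne hu).symm) hxs (left_mem_segment ℝ _ _) h1 h2
  rw [segment_same, mem_singleton_iff] at hz2
  rw [hz2, segment_symm] at hz1
  exact hpl.not_mem_segment hu hwu hwp hz1

/-- The cones of two distinct edges incident to `T.parent u` share only the apex; `w'` is the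
endpoint of the edge of `w` other than `T.parent u`. -/
theorem IsPlanarD.eq_zero_of_inCone (hpl : IsPlanarD T Γ) (hgr : IsGridD Γ) (hD : 1 ≤ D)
    (hx : ∀ v w, |(Γ v).1 - (Γ w).1| ≤ D) (hy : ∀ v w, |(Γ v).2 - (Γ w).2| ≤ D)
    {u w w' : V} (hu : u ≠ T.root) (hw : w ≠ T.root) (huw : u ≠ w)
    (hw' : (w = T.parent u ∧ w' = T.parent w) ∨ (T.parent w = T.parent u ∧ w' = w))
    {q : ℝ × ℝ}
    (h1 : InCone (aperture D (Γ u - Γ (T.parent u))) (Γ u - Γ (T.parent u)) q)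
    (h2 : InCone (aperture D (Γ w' - Γ (T.parent u))) (Γ w' - Γ (T.parent u)) q) : q = 0 := by
  by_contra hq
  have hne : w' ≠ T.parent u := by
    rcases hw' with ⟨rfl, rfl⟩ | ⟨h, rfl⟩
    · exact T.parent_ne hw
    · rw [← h]
      exact (T.parent_ne hw).symm
  have hne2 : u ≠ w' := by
    rcases hw' with ⟨rfl, rfl⟩ | ⟨h, rfl⟩
    · exact (T.parent_parent_ne hu).symm
    · exact huw
  obtain ⟨s, hs, r, hr, hs0, e⟩ := exists_smul_eq_smul_of_inCone hD
    (sub_mem (hgr.fst_mem _) (hgr.fst_mem _)) (sub_mem (hgr.snd_mem _) (hgr.snd_mem _))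
    (sub_mem (hgr.fst_mem _) (hgr.fst_mem _)) (sub_mem (hgr.snd_mem _) (hgr.snd_mem _))
    (hgr.one_le_max_abs_sub (hpl.1.ne (T.parent_ne hu).symm))
    (hgr.one_le_max_abs_sub (hpl.1.ne hne)) (max_le (hx _ _) (hy _ _))
    (max_le (hx _ _) (hy _ _)) hq h1 h2
  have m1 : Γ (T.parent u) + s • (Γ u - Γ (T.parent u)) ∈
      segment ℝ (Γ u) (Γ (T.parent u)) := by
    rw [segment_symm]
    exact mem_segment_iff_exists_smul.2 ⟨s, hs, rfl⟩
  have m2 : Γ (T.parent u) + s • (Γ u - Γ (T.parent u)) ∈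
      segment ℝ (Γ w) (Γ (T.parent w)) := by
    have : Γ (T.parent u) + s • (Γ u - Γ (T.parent u)) ∈ segment ℝ (Γ (T.parent u)) (Γ w') :=
      mem_segment_iff_exists_smul.2 ⟨r, hr, by rw [e]⟩
    rcases hw' with ⟨rfl, rfl⟩ | ⟨h, rfl⟩
    · exact this
    · rwa [h, segment_symm]
  obtain ⟨z, ⟨hz1, hz2⟩, ez⟩ := hpl.2 u w hu hw huw ⟨m1, m2⟩
  have hzp : z ≠ T.parent u := by
    rintro rfl
    have := smul_eq_zero.1 (left_eq_add.1 ez)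
    rcases this with h | h
    · exact hs0 h
    · exact hpl.1.ne (T.parent_ne hu).symm (sub_eq_zero.1 h)
  have hzu : z = u := hz1.resolve_right hzp
  subst hzu
  rcases hw' with ⟨rfl, rfl⟩ | ⟨h, rfl⟩
  · rcases hz2 with h | h
    · exact hzp h
    · exact hne2 h
  · rcases hz2 with h' | h'
    · exact huw h'
    · exact hzp (h'.trans h)

theorem inCone_smul_self {t r : ℝ} (ht : 0 ≤ t) (hr : 0 ≤ r) (d : ℝ × ℝ) :
    InCone t d (r • d) := by
  unfold InCone
  have h1 : d.1 * (r • d).2 - d.2 * (r • d).1 = 0 := by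
    simp only [Prod.smul_fst, Prod.smul_snd, smul_eq_mul]; ring
  have h2 : d.1 * (r • d).1 + d.2 * (r • d).2 = r * (d.1 ^ 2 + d.2 ^ 2) := by
    simp only [Prod.smul_fst, Prod.smul_snd, smul_eq_mul]; ring
  rw [h1, h2, abs_zero]
  positivity

theorem IsPlanarD.edgeSector_inter_segment_subset (hpl : IsPlanarD T Γ) (hgr : IsGridD Γ)
    (hD : 1 ≤ D) (hB : 0 < B)
    (hx : ∀ v w, |(Γ v).1 - (Γ w).1| ≤ D) (hy : ∀ v w, |(Γ v).2 - (Γ w).2| ≤ D)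
    {u w : V} (hu : u ≠ T.root) (hw : w ≠ T.root) (hanc : ¬ T.AncEq u w) :
    segment ℝ (B • Γ w) (B • Γ (T.parent w)) ∩ edgeSector T Γ D B u ⊆
      {B • Γ (T.parent u)} := by
  rintro p ⟨hp, hpS⟩
  have huw : u ≠ w := by
    rintro rfl
    exact hanc (OTree.AncEq.refl T u)
  have hupw : u ≠ T.parent w := by
    rintro rfl
    exact hanc ⟨1, rfl⟩
  obtain ⟨y, hys, rfl⟩ := exists_eq_smul_of_mem_segment_smul hp
  by_cases hinc : w = T.parent u ∨ T.parent w = T.parent u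
  · obtain ⟨w', hw', hyw⟩ : ∃ w', ((w = T.parent u ∧ w' = T.parent w) ∨
        (T.parent w = T.parent u ∧ w' = w)) ∧ y ∈ segment ℝ (Γ (T.parent u)) (Γ w') := by
      rcases hinc with h | h
      · exact ⟨T.parent w, Or.inl ⟨h, rfl⟩, by rwa [← h]⟩
      · exact ⟨w, Or.inr ⟨h, rfl⟩, by rwa [← h, segment_symm]⟩
    obtain ⟨r, hr, rfl⟩ := mem_segment_iff_exists_smul.1 hyw
    have hne : w' ≠ T.parent u := by
      rcases hw' with ⟨rfl, rfl⟩ | ⟨h, rfl⟩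
      · exact T.parent_ne hw
      · rw [← h]
        exact (T.parent_ne hw).symm
    have ht := aperture_pos hD (hgr.one_le_max_abs_sub (hpl.1.ne hne))
    have h2 : InCone (aperture D (Γ w' - Γ (T.parent u))) (Γ w' - Γ (T.parent u))
        (B • (Γ (T.parent u) + r • (Γ w' - Γ (T.parent u))) - B • Γ (T.parent u)) := by
      rw [smul_add, add_sub_cancel_left, smul_smul]
      exact inCone_smul_self ht.le (mul_nonneg hB.le hr.1) _
    exact sub_eq_zero.1 (hpl.eq_zero_of_inCone hgr hD hx hy hu hw huw hw' hpS.1 h2)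
  · push Not at hinc
    exfalso
    obtain ⟨x, hxs, hpx⟩ := exists_nearScaled_of_mem_edgeSector hgr hpl.1 hD hB hu hpS
    obtain ⟨h1, h2⟩ := hpx.close hD hB (nearScaled_smul hB y)
    obtain ⟨z, hz1, hz2⟩ := hgr.segment_inter_nonempty hD hx hy
      (hpl.1.ne (T.parent_ne hu).symm) hxs hys h1 h2
    rw [segment_symm] at hz1
    obtain ⟨z', ⟨ha, hb⟩, -⟩ := hpl.2 u w hu hw huw ⟨hz1, hz2⟩
    rcases ha with rfl | rfl <;> rcases hb with h | h
    · exact huw h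
    · exact hupw h
    · exact hinc.1 h.symm
    · exact hinc.2 h.symm

theorem IsPlanarD.interior_edgeSector_inter (hpl : IsPlanarD T Γ) (hgr : IsGridD Γ)
    (hD : 1 ≤ D)
    (hx : ∀ v w, |(Γ v).1 - (Γ w).1| ≤ D) (hy : ∀ v w, |(Γ v).2 - (Γ w).2| ≤ D)
    {u w : V} (hu : u ≠ T.root) (hw : w ≠ T.root) (huw : u ≠ w)
    (hp : T.parent u = T.parent w) :
    interior (edgeSector T Γ D B u) ∩ interior (edgeSector T Γ D B w) = ∅ := by
  rw [← interior_inter, ← subset_empty_iff, ← interior_singleton (B • Γ (T.parent u))]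
  apply interior_mono
  rintro p ⟨h1, h2⟩
  have h2' := h2.1
  rw [← hp] at h2'
  exact sub_eq_zero.1 (hpl.eq_zero_of_inCone hgr hD hx hy hu hw huw (Or.inr ⟨hp.symm, rfl⟩)
    h1.1 h2')

theorem boxAt_subset_edgeSector (hgr : IsGridD Γ) (hinj : Function.Injective Γ)
    {n k : ℝ} (hD : 1 ≤ D) (hn : 0 < n) (hk : 70 * D * n ≤ k) (hkB : k ≤ B)
    (hB : 800 * D * n ≤ B) {u : V} (hu : u ≠ T.root) :
    boxAt (2 * n) (B • Γ (T.parent u) + k • (Γ u - Γ (T.parent u))) ⊆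
      edgeSector T Γ D B u := by
  rintro p ⟨h1, h2⟩
  have hd := hgr.one_le_max_abs_sub (hinj.ne (T.parent_ne hu).symm)
  have hk0 : 0 ≤ k := le_trans (by positivity) hk
  have e1 : |(p - B • Γ (T.parent u)).1 - k * (Γ u - Γ (T.parent u)).1| ≤ n := by
    convert h1 using 1
    · congr 1
      simp only [Prod.fst_sub, Prod.fst_add, Prod.smul_fst, smul_eq_mul]
      ring
    · ring
  have e2 : |(p - B • Γ (T.parent u)).2 - k * (Γ u - Γ (T.parent u)).2| ≤ n := by
    convert h2 using 1
    · congr 1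
      simp only [Prod.snd_sub, Prod.snd_add, Prod.smul_snd, smul_eq_mul]
      ring
    · ring
  refine ⟨inCone_of_mem_box hD hn hd hk e1 e2, ?_⟩
  rw [sq_mul_sqrt_sq_add_sq]
  exact sq_add_sq_le_of_mem_box hD hn hd hk0 hkB hB e1 e2

theorem isSector_edgeSector (hgr : IsGridD Γ) (hinj : Function.Injective Γ) (hD : 1 ≤ D)
    (hB : 0 < B) {u : V} (hu : u ≠ T.root) :
    IsSector (B • Γ (T.parent u)) (edgeSector T Γ D B u) := by
  have hd := hgr.one_le_max_abs_sub (hinj.ne (T.parent_ne hu).symm)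
  have ht := aperture_pos hD hd
  have hsq := sq_max_le_sq_add_sq (Γ u - Γ (T.parent u)).1 (Γ u - Γ (T.parent u)).2
  have hN : 0 < (Γ u - Γ (T.parent u)).1 ^ 2 + (Γ u - Γ (T.parent u)).2 ^ 2 :=
    lt_of_lt_of_le (by positivity) hsq
  exact isSector_sectorAt (sub_ne_zero.2 (hinj.ne (T.parent_ne hu).symm)) ht (by positivity)

theorem IsPlanarD.partiallyCanonical_smul (hpl : IsPlanarD T Γ) (hop : IsOrderPreservingD T Γ)
    (hgr : IsGridD Γ) (hDi : D ∈ intReals) (hD : 1 ≤ D)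
    (hx : ∀ v w, |(Γ v).1 - (Γ w).1| ≤ D) (hy : ∀ v w, |(Γ v).2 - (Γ w).2| ≤ D) :
    PartiallyCanonical T (fun v => T.IsLeaf v) (150 * D ^ 2 * (Fintype.card V : ℝ))
      (fun v => (800 * D ^ 3 * (Fintype.card V : ℝ)) • Γ v) := by
  have : Nonempty V := ⟨T.root⟩
  have hn1 : 1 ≤ (Fintype.card V : ℝ) := by exact_mod_cast Fintype.card_pos
  have hni : (Fintype.card V : ℝ) ∈ intReals := natCast_mem _ _
  set n : ℝ := (Fintype.card V : ℝ)
  have hn : 0 < n := by linarith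
  have hB : 0 < 800 * D ^ 3 * n := by positivity
  have hBi : 800 * D ^ 3 * n ∈ intReals :=
    mul_mem (mul_mem (ofNat_mem _ 800) (pow_mem hDi 3)) hni
  have hnear : ∀ {p x : ℝ × ℝ},
      p ∈ boxAt (150 * D ^ 2 * n + 4 * n) ((800 * D ^ 3 * n) • x) →
      NearScaled D (800 * D ^ 3 * n) p x := fun h => NearScaled.of_mem_boxAt hD hn h
  have hDn : D * n ≤ D ^ 3 * n := by
    gcongr
    exact le_self_pow₀ hD (by norm_num)
  have hDn0 : 0 < D * n := by positivity
  have hB1 : 800 * D * n ≤ 800 * D ^ 3 * n := by linarith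
  have hB2 : 70 * D * n ≤ 800 * D ^ 3 * n := by linarith
  set B := 800 * D ^ 3 * n with hBdef
  have hbox : ∀ v w, v ≠ w → ∀ p, NearScaled D B p (Γ v) → ¬ NearScaled D B p (Γ w) := by
    intro v w hvw p h1 h2
    obtain ⟨k1, k2⟩ := h1.close hD hB h2
    apply hvw
    apply hpl.1
    ext
    · apply sub_eq_zero.1
      apply eq_zero_of_mem_intReals (sub_mem (hgr.fst_mem v) (hgr.fst_mem w))
      nlinarith [abs_nonneg ((Γ v).1 - (Γ w).1)]
    · apply sub_eq_zero.1
      apply eq_zero_of_mem_intReals (sub_mem (hgr.snd_mem v) (hgr.snd_mem w))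
      nlinarith [abs_nonneg ((Γ v).2 - (Γ w).2)]
  refine ⟨hop.smul hB, hpl.smul hB, hgr.smul hBi, ?_,
    ⟨edgeSector T Γ D B, ?_, ?_, ?_⟩, ?_, ?_⟩
  · intro u hu
    exact ⟨Or.inl (hu.upCanonicalOn (hgr.smul hBi)), fun _ =>
      ⟨fun _ => hu.upCanonicalOn (hgr.smul hBi), fun _ => hu.downCanonicalOn (hgr.smul hBi)⟩⟩
  · intro u hu _
    refine ⟨isSector_edgeSector hgr hpl.1 hD hB hu, ?_, ?_, ?_, ?_⟩
    · have := boxAt_subset_edgeSector hgr hpl.1 hD hn hB2 le_rfl hB1 hu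
      rwa [← smul_add, add_sub_cancel] at this
    · intro w hwS
      by_contra! hc
      have hwu : w ≠ u := by
        rintro rfl
        exact hc.2 (OTree.AncEq.refl T w)
      obtain ⟨x, hxs, hpx⟩ := exists_nearScaled_of_mem_edgeSector hgr hpl.1 hD hB hu hwS
      exact hpl.not_nearScaled_of_mem_segment hgr hD hB hx hy hu hwu hc.1 hxs hpx
        (nearScaled_smul hB _)
    · intro w hw hanc
      exact hpl.edgeSector_inter_segment_subset hgr hD hB hx hy hu hw hanc
    · have hki : 70 * D * n ∈ intReals := mul_mem (mul_mem (ofNat_mem _ 70) hDi) hni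
      obtain ⟨c₁, hc₁⟩ := mem_intReals_iff.1 (add_mem (mul_mem hBi (hgr.fst_mem (T.parent u)))
        (mul_mem hki (sub_mem (hgr.fst_mem u) (hgr.fst_mem (T.parent u)))))
      obtain ⟨c₂, hc₂⟩ := mem_intReals_iff.1 (add_mem (mul_mem hBi (hgr.snd_mem (T.parent u)))
        (mul_mem hki (sub_mem (hgr.snd_mem u) (hgr.snd_mem (T.parent u)))))
      have hk0 : 0 < 70 * D * n := by positivity
      have aux : ∀ p a b : ℝ, |p - (B * a + 70 * D * n * (b - a))| ≤ 2 * n / 2 →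
          |b - a| ≤ D → |p - B * a| ≤ 150 * D ^ 2 * n / 2 := by
        intro p a b h1 h2
        have h3 : |p - B * a| ≤ 2 * n / 2 + 70 * D * n * |b - a| := by
          calc |p - B * a|
              = |(p - (B * a + 70 * D * n * (b - a))) + 70 * D * n * (b - a)| := by
                congr 1; ring
            _ ≤ _ := by
                refine (abs_add_le _ _).trans ?_
                rw [abs_mul, abs_of_pos hk0]
                linarith
        have h4 := mul_le_mul_of_nonneg_left h2 hk0.le
        have h5 : n ≤ D ^ 2 * n := le_mul_of_one_le_left hn.le (one_le_pow₀ hD)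
        linarith
      refine ⟨(c₁, c₂), subset_inter ?_ ?_, ?_⟩
      · have := boxAt_subset_edgeSector hgr hpl.1 hD hn le_rfl hB2 hB1 hu
        convert this using 2
        exact Prod.ext hc₁.symm hc₂.symm
      · rintro p ⟨h1, h2⟩
        simp only [← hc₁, ← hc₂] at h1 h2
        exact ⟨aux _ _ _ h1 (hx _ _), aux _ _ _ h2 (hy _ _)⟩
      · simp only [← hc₂, Prod.smul_snd, smul_eq_mul]
        rw [mul_le_mul_iff_right₀ hB, add_le_iff_nonpos_right, mul_nonpos_iff_pos_imp_nonpos]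
        exact ⟨fun h => sub_nonpos.1 (h.1 hk0), fun h =>
          ⟨fun _ => sub_nonpos.2 h, fun _ => hk0.le⟩⟩
  · intro u u' hu hu' _ hp hne
    exact hpl.interior_edgeSector_inter hgr hD hx hy hu hu' hne hp
  · rintro v - u hu - ⟨p, hpS, hpv⟩
    by_contra! hc
    obtain ⟨x, hxs, hpx⟩ := exists_nearScaled_of_mem_edgeSector hgr hpl.1 hD hB hu hpS
    exact hpl.not_nearScaled_of_mem_segment hgr hD hB hx hy hu hc.2.symm hc.1.symm hxs hpx
      (hnear hpv)
  · intro v w _ _ hvw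
    rw [eq_empty_iff_forall_notMem]
    rintro p ⟨h1, h2⟩
    exact hbox v w hvw p (hnear h1) (hnear h2)
  · intro v _
    refine ⟨fun w hwv hmem => hbox w v hwv _ (nearScaled_smul hB _) (hnear hmem), ?_⟩
    rintro w hw ⟨p, hps, hpv⟩
    by_contra! hc
    obtain ⟨y, hys, rfl⟩ := exists_eq_smul_of_mem_segment_smul hps
    rw [segment_symm] at hys
    exact hpl.not_nearScaled_of_mem_segment hgr hD hB hx hy hw hc.2.symm hc.1.symm hys
      (nearScaled_smul hB y) (hnear hpv)

end Drawing


/-- **Lemma 5.** Let `T` be an `n`-node ordered tree rooted at a leaf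
(the root has at most one child), let `Γ₀` be an order-preserving straight-line planar
grid drawing of `T`, and let `D₀ = max {w(Γ₀), h(Γ₀)}`. Then there is an integer
`B₀ ∈ O(D₀³·n)` — in particular `B₀ = 800·D₀³·n` suffices — such that the drawing
obtained by scaling `Γ₀` up by `B₀` is a partially-canonical drawing of `T[0]`
(all leaves visited, all internal nodes unvisited), with `ℓ₀ = 150·D₀²·n`. -/
theorem scaled_drawing_partially_canonical (T : OTree V) (Γ₀ : V → ℝ × ℝ)
    (hrootleaf : ∀ c c', T.IsChild c T.root → T.IsChild c' T.root → c = c')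
    (hop : IsOrderPreservingD T Γ₀) (hpl : IsPlanarD T Γ₀) (hgr : IsGridD Γ₀) :
    ∃ B₀ : ℝ, (∃ b : ℤ, B₀ = (b : ℝ)) ∧
      B₀ = 800 * (max (gW Γ₀) (gH Γ₀)) ^ 3 * (Fintype.card V : ℝ) ∧
      PartiallyCanonical T (fun v => T.IsLeaf v)
        (150 * (max (gW Γ₀) (gH Γ₀)) ^ 2 * (Fintype.card V : ℝ))
        (fun v => B₀ • Γ₀ v) := by
  have : Nonempty V := ⟨T.root⟩
  have hW : gW Γ₀ ∈ intReals := add_mem (sSup_range_sub_sInf_range_mem hgr.fst_mem) (one_mem _)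
  have hH : gH Γ₀ ∈ intReals := add_mem (sSup_range_sub_sInf_range_mem hgr.snd_mem) (one_mem _)
  have hx : ∀ v w, |(Γ₀ v).1 - (Γ₀ w).1| + 1 ≤ gW Γ₀ := fun v w =>
    add_le_add_left (abs_sub_le_sSup_range_sub_sInf_range (fun v => (Γ₀ v).1) v w) 1
  have hy : ∀ v w, |(Γ₀ v).2 - (Γ₀ w).2| + 1 ≤ gH Γ₀ := fun v w =>
    add_le_add_left (abs_sub_le_sSup_range_sub_sInf_range (fun v => (Γ₀ v).2) v w) 1
  set D := max (gW Γ₀) (gH Γ₀) with hDdef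
  have hWD : gW Γ₀ ≤ D := le_max_left _ _
  have hHD : gH Γ₀ ≤ D := le_max_right _ _
  have hDi : D ∈ intReals := by
    rcases max_choice (gW Γ₀) (gH Γ₀) with h | h <;> rwa [hDdef, h]
  have hD : 1 ≤ D := by
    linarith [hx T.root T.root, abs_nonneg ((Γ₀ T.root).1 - (Γ₀ T.root).1)]
  refine ⟨800 * D ^ 3 * (Fintype.card V : ℝ), mem_intReals_iff.1 ?_, rfl, ?_⟩
  · exact mul_mem (mul_mem (ofNat_mem _ 800) (pow_mem hDi 3)) (natCast_mem _ _)
  · exact hpl.partiallyCanonical_smul hop hgr hDi hD (fun v w => by linarith [hx v w])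
      (fun v w => by linarith [hy v w])
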